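/- Let I be a closed two-sided ideal of a unital C*-algebra A such that I has stable rank one and A/I is extremally rich. Then A is extremally rich if and only if every extremal partial isometry in A/I lifts to an extremal partial isometry in A. -/

import Mathlib

/-- A unital C*-algebra `A` is *extremally rich* if the set
`A⁻¹ 𝓔(A) A⁻¹ = {x * u * y : x, y invertible, u an extreme point of the closed unit ball}`
is dense in `A`. -/
def ExtremallyRich (A : Type*) [CStarAlgebra A] : Prop :=
  Dense {a : A | ∃ x u y : A, IsUnit x ∧ IsUnit y ∧
    u ∈ Set.extremePoints ℝ (Metric.closedBall (0 : A) 1) ∧ a = x * u * y}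

section
attribute [local instance] CStarAlgebra.spectralOrder CStarAlgebra.spectralOrderedRing
variable {A : Type*} [CStarAlgebra A]

theorem norm_le_one_iff_star_mul_self_le_one {a : A} : ‖a‖ ≤ 1 ↔ star a * a ≤ 1 := by
  rw [← CStarAlgebra.norm_le_one_iff_of_nonneg _ (star_mul_self_nonneg a),
    CStarRing.norm_star_mul_self, ← sq, sq_le_one_iff₀ (norm_nonneg a)]

theorem sub_mul_star_mul_self_eq_zero {v a b : A} {t s : ℝ} (hv : v * star v * v = v)
    (ha : ‖a‖ ≤ 1) (hb : ‖b‖ ≤ 1) (ht : 0 < t) (hs : 0 < s) (hts : t + s = 1)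
    (h : t • a + s • b = v) : (a - b) * (star v * v) = 0 := by
  have ha' := smul_le_smul_of_nonneg_left (norm_le_one_iff_star_mul_self_le_one.1 ha) ht.le
  have hb' := smul_le_smul_of_nonneg_left (norm_le_one_iff_star_mul_self_le_one.1 hb) hs.le
  have key : (t * s) • (star (a - b) * (a - b)) ≤ 1 - star v * v := by
    have e : (t * s) • (star (a - b) * (a - b)) + star v * v
        = t • (star a * a) + s • (star b * b) := by
      obtain rfl : s = 1 - t := by linarith
      simp only [← h, star_add, star_sub, star_smul, star_trivial, mul_add, add_mul, mul_sub,
        sub_mul, smul_mul_assoc, mul_smul_comm]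
      match_scalars <;> ring
    rw [le_sub_iff_add_le, e]
    refine (add_le_add ha' hb').trans_eq ?_
    rw [← add_smul, hts, one_smul]
  have hP : star v * v * (star v * v) = star v * v := by
    rw [mul_assoc, ← mul_assoc v, hv]
  have h2 := star_left_conjugate_le_conjugate key (star v * v)
  have e2 : star (star v * v) * (1 - star v * v) * (star v * v) = 0 := by
    rw [star_mul, star_star, mul_sub, mul_one, hP, sub_self, zero_mul]
  have e3 : star (star v * v) * ((t * s) • (star (a - b) * (a - b))) * (star v * v)
      = (t * s) • (star ((a - b) * (star v * v)) * ((a - b) * (star v * v))) := by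
    simp only [star_mul, mul_smul_comm, smul_mul_assoc, mul_assoc]
  rw [e2, e3] at h2
  have h3 := h2.antisymm (smul_nonneg (mul_pos ht hs).le (star_mul_self_nonneg _))
  rw [smul_eq_zero_iff_right (mul_pos ht hs).ne'] at h3
  exact CStarRing.star_mul_self_eq_zero_iff _ |>.1 h3

theorem mem_extremePoints_closedBall_of_forall {v : A} (hv : v * star v * v = v)
    (h : ∀ a, (1 - v * star v) * a * (1 - star v * v) = 0) :
    v ∈ Set.extremePoints ℝ (Metric.closedBall (0 : A) 1) := by
  have hP : star v * v * (star v * v) = star v * v := by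
    rw [mul_assoc, ← mul_assoc v, hv]
  simp only [mem_extremePoints_iff_left, mem_closedBall_zero_iff]
  refine ⟨?_, ?_⟩
  · rw [norm_le_one_iff_star_mul_self_le_one, ← sub_nonneg]
    have : 1 - star v * v = star (1 - star v * v) * (1 - star v * v) := by
      simp [mul_sub, sub_mul, hP]
    rw [this]
    exact star_mul_self_nonneg _
  · rintro a ha b hb ⟨t, s, ht, hs, hts, hab⟩
    have h1 := sub_mul_star_mul_self_eq_zero hv ha hb ht hs hts hab
    have h2 : star ((a - b)) * (v * star v) = 0 := by
      have := sub_mul_star_mul_self_eq_zero (v := star v) (a := star a) (b := star b)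
        (by simpa [mul_assoc] using congrArg star hv) (by simpa) (by simpa) ht hs hts
        (by rw [← hab]; simp)
      simpa using this
    have h3 : v * star v * (a - b) = 0 := by simpa [mul_assoc] using congrArg star h2
    have h4 := h (a - b)
    rw [sub_mul, one_mul, h3, sub_zero, mul_sub, mul_one, h1, sub_zero, sub_eq_zero] at h4
    rw [← hab, ← h4, ← add_smul, hts, one_smul]

theorem eq_zero_of_mem_extremePoints_closedBall {v z : A}
    (hv : v ∈ Set.extremePoints ℝ (Metric.closedBall (0 : A) 1))
    (h₁ : ‖v + z‖ ≤ 1) (h₂ : ‖v - z‖ ≤ 1) : z = 0 := by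
  simp only [mem_extremePoints_iff_left, mem_closedBall_zero_iff] at hv
  have := hv.2 _ h₁ _ h₂ ⟨1 / 2, 1 / 2, by norm_num, by norm_num, by norm_num, by
    match_scalars <;> norm_num⟩
  simpa using this

theorem mul_star_mul_self_of_mem_extremePoints_closedBall {v : A}
    (hv : v ∈ Set.extremePoints ℝ (Metric.closedBall (0 : A) 1)) : v * star v * v = v := by
  have hn : ‖v‖ ≤ 1 := by simpa using hv.1
  have hs : star v * v ≤ 1 := norm_le_one_iff_star_mul_self_le_one.1 hn
  have hs0 : 0 ≤ star v * v := star_mul_self_nonneg v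
  have key : ∀ w : A, star w * (star v * v) * w ≤ 4 → ‖(1 / 2 : ℝ) • (v * w)‖ ≤ 1 := by
    intro w hw
    rw [norm_le_one_iff_star_mul_self_le_one]
    have e : star ((1 / 2 : ℝ) • (v * w)) * ((1 / 2 : ℝ) • (v * w))
        = (1 / 4 : ℝ) • (star w * (star v * v) * w) := by
      simp only [star_smul, star_trivial, star_mul, mul_smul_comm, smul_mul_assoc, mul_assoc,
        smul_smul]
      norm_num
    rw [e]
    refine (smul_le_smul_of_nonneg_left hw (by norm_num)).trans_eq ?_
    rw [show (4 : A) = (4 : ℝ) • (1 : A) by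
      rw [← Algebra.algebraMap_eq_smul_one, map_ofNat], smul_smul]
    norm_num
  set s := star v * v with hsdef
  have hss : star s = s := by simp [hsdef]
  have h := eq_zero_of_mem_extremePoints_closedBall (z := (1 / 2 : ℝ) • (v * (1 - s))) hv ?_ ?_
  · rw [smul_eq_zero_iff_right (by norm_num), mul_sub, mul_one, sub_eq_zero] at h
    rw [mul_assoc, ← hsdef, ← h]
  · convert key (3 - s) ?_ using 2
    · rw [show (3 : A) - s = 2 + (1 - s) by grind, mul_add, mul_two]
      module
    · rw [← sub_nonneg]
      have e : 4 - star (3 - s) * s * (3 - s) = star (1 - s) * (4 - s) * (1 - s) := by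
        simp only [star_sub, hss, star_one, star_ofNat]
        grind
      rw [e]
      refine star_left_conjugate_nonneg ?_ _
      rw [show (4 : A) - s = 3 + (1 - s) by grind]
      exact add_nonneg (by norm_num) (sub_nonneg.2 hs)
  · convert key (1 + s) ?_ using 2
    · rw [show (1 : A) + s = 2 - (1 - s) by grind, mul_sub v 2, mul_two]
      module
    · rw [← sub_nonneg]
      have e : 4 - star (1 + s) * s * (1 + s)
          = 4 * (1 - s) + 3 * (s * (1 - s)) + star s * (1 - s) * s := by
        simp only [star_add, hss, star_one]
        grind
      rw [e]
      have h1 : (0 : A) ≤ 1 - s := sub_nonneg.2 hs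
      have h2 : (0 : A) ≤ s * (1 - s) :=
        Commute.mul_nonneg hs0 h1 ((Commute.one_right s).sub_right (Commute.refl s))
      have h3 := star_left_conjugate_nonneg h1 s
      have h4 : 4 * (1 - s) = 4 • (1 - s) := by simp
      have h5 : 3 * (s * (1 - s)) = 3 • (s * (1 - s)) := by simp
      rw [h4, h5]
      exact add_nonneg (add_nonneg (nsmul_nonneg h1 _) (nsmul_nonneg h2 _)) h3

theorem defect_mul_defect_of_mem_extremePoints_closedBall {v : A}
    (hv : v ∈ Set.extremePoints ℝ (Metric.closedBall (0 : A) 1)) (a : A) :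
    (1 - v * star v) * a * (1 - star v * v) = 0 := by
  have hvv := mul_star_mul_self_of_mem_extremePoints_closedBall hv
  have hP : star v * v * (star v * v) = star v * v := by
    rw [mul_assoc, ← mul_assoc v, hvv]
  have hvr : star v * (1 - v * star v) = 0 := by
    have : star v * v * star v = star v := by simpa [mul_assoc] using congrArg star hvv
    rw [mul_sub, mul_one, ← mul_assoc, this, sub_self]
  have hp : star (1 - star v * v) * (1 - star v * v) = 1 - star v * v := by
    simp [mul_sub, sub_mul, hP]
  -- after rescaling, the defect product is a perturbation orthogonal to `v`
  set y := (1 - v * star v) * a with hy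
  set c : ℝ := (1 + ‖y‖)⁻¹ with hc
  have hc0 : 0 < c := by positivity
  have hvy : star v * y = 0 := by rw [hy, ← mul_assoc, hvr, zero_mul]
  have hyv : star y * v = 0 := by simpa using congrArg star hvy
  have hcy : star (c • y) * (c • y) ≤ 1 := by
    rw [← norm_le_one_iff_star_mul_self_le_one, norm_smul, Real.norm_of_nonneg hc0.le, hc,
      inv_mul_le_one₀ (by positivity)]
    linarith
  have hle : ∀ z : A, star z * v = 0 → star v * z = 0 → star z * z ≤ 1 - star v * v →
      ‖v + z‖ ≤ 1 := by
    intro z h1 h2 h3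
    rw [norm_le_one_iff_star_mul_self_le_one, star_add, add_mul, mul_add, mul_add, h1, h2,
      add_zero, zero_add]
    rwa [le_sub_iff_add_le'] at h3
  have hz : star ((c • y) * (1 - star v * v)) * ((c • y) * (1 - star v * v)) ≤
      1 - star v * v := by
    have := star_left_conjugate_le_conjugate hcy (1 - star v * v)
    rw [mul_one, hp] at this
    simpa only [star_mul, mul_assoc] using this
  have h1 : star ((c • y) * (1 - star v * v)) * v = 0 := by
    simp [mul_assoc, hyv]
  have h2 : star v * ((c • y) * (1 - star v * v)) = 0 := by
    rw [← mul_assoc, mul_smul_comm, hvy, smul_zero, zero_mul]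
  have := eq_zero_of_mem_extremePoints_closedBall hv (hle _ h1 h2 hz)
    (by rw [sub_eq_add_neg]; exact hle _ (by simpa using h1) (by simpa using h2) (by simpa using hz))
  rwa [smul_mul_assoc, smul_eq_zero_iff_right hc0.ne'] at this

/-- If `b` is von Neumann regular, then the spectrum of `star b * b` has a gap at zero. -/
theorem exists_pos_le_of_mem_spectrum_star_mul_self {b c : A} (h : b * c * b = b) :
    ∃ δ : ℝ, 0 < δ ∧ ∀ t ∈ spectrum ℝ (star b * b), t ≠ 0 → δ ≤ t := by
  set s := star b * b with hs
  have hs0 : 0 ≤ s := star_mul_self_nonneg b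
  have hss : star s = s := by simp [hs]
  have h1 : s ≤ s * (c * star c) * s := by
    have key := star_mul_self_nonneg (b - star c * s)
    have e1 : s * c * b = s := by rw [hs, mul_assoc, mul_assoc, ← mul_assoc b, h]
    have e2 : star b * star c * s = s := by simpa [hss, mul_assoc] using congrArg star e1
    have e : star (b - star c * s) * (b - star c * s) = s * (c * star c) * s - s := by
      simp only [star_sub, star_mul, star_star, hss]
      have : (star b - s * c) * (b - star c * s)
          = star b * b - s * c * b - star b * star c * s + s * (c * star c) * s := by
        noncomm_ring
      rw [this, e1, e2, ← hs]
      abel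
    rwa [e, sub_nonneg] at key
  have h2 : s * (c * star c) * s ≤ (‖c‖ ^ 2 + 1 : ℝ) • (s * s) := by
    have h3 : c * star c ≤ algebraMap ℝ A (‖c‖ ^ 2) := by
      simpa using CStarAlgebra.star_mul_le_algebraMap_norm_sq (a := star c)
    have h4 := star_left_conjugate_le_conjugate h3 s
    rw [hss] at h4
    refine h4.trans ?_
    rw [Algebra.algebraMap_eq_smul_one, mul_smul_comm, mul_one, smul_mul_assoc, add_smul]
    refine le_add_of_nonneg_right (smul_nonneg zero_le_one ?_)
    simpa [hss] using star_mul_self_nonneg s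
  set C : ℝ := ‖c‖ ^ 2 + 1 with hC
  have hC0 : 0 < C := by positivity
  refine ⟨C⁻¹, by positivity, fun t ht ht0 ↦ ?_⟩
  have hsa : IsSelfAdjoint s := hss
  have h5 : cfc (fun t : ℝ ↦ C * (t * t) - t) s = C • (s * s) - s := by
    rw [cfc_sub _ _ s, cfc_const_mul _ _ s, cfc_mul _ _ s, cfc_id' ℝ s]
  have h6 := (cfc_nonneg_iff (fun t : ℝ ↦ C * (t * t) - t) s).1
    (by rw [h5, sub_nonneg]; exact h1.trans h2) t ht
  have h7 : 0 < t := lt_of_le_of_ne (spectrum_nonneg_of_nonneg hs0 ht) ht0.symm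
  rw [inv_le_iff_one_le_mul₀ hC0]
  nlinarith

theorem continuousOn_log_spectrum_star_mul_self {b c : A} (h : b * c * b = b) :
    ContinuousOn Real.log (spectrum ℝ (star b * b)) := by
  obtain ⟨δ, hδ, hgap⟩ := exists_pos_le_of_mem_spectrum_star_mul_self h
  intro t ht
  by_cases ht0 : t = 0
  · subst ht0
    refine (continuousWithinAt_const (b := (0 : ℝ))).congr_of_eventuallyEq ?_ Real.log_zero
    filter_upwards [self_mem_nhdsWithin, mem_nhdsWithin_of_mem_nhds (Iio_mem_nhds hδ)]
      with x hx hxδ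
    have : x = 0 := by
      by_contra hx0
      exact absurd (hgap x hx hx0) (not_le.2 hxδ)
    simp [this]
  · exact (Real.continuousAt_log ht0).continuousWithinAt

theorem exp_cfc_neg_half_log {s : A} (hs : IsSelfAdjoint s)
    (hc : ContinuousOn Real.log (spectrum ℝ s)) :
    NormedSpace.exp (cfc (fun t ↦ -(Real.log t / 2)) s)
      = cfc (fun t ↦ Real.exp (-(Real.log t / 2))) s := by
  rw [← CFC.real_exp_eq_normedSpace_exp (cfc_predicate _ _),
    ← cfc_comp Real.exp _ s hs (by fun_prop) (by fun_prop)]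
  rfl

theorem isUnit_normedSpace_exp (a : A) : IsUnit (NormedSpace.exp a) := by
  let _ : NormedAlgebra ℚ A := NormedAlgebra.restrictScalars ℚ ℝ A
  exact NormedSpace.isUnit_exp a

/-- The partial isometry in the polar decomposition of an invertible multiple of an extremal
partial isometry is extremal. -/
theorem mul_exp_mem_extremePoints_closedBall {b x u y : A} (hx : IsUnit x) (hy : IsUnit y)
    (hu : u ∈ Set.extremePoints ℝ (Metric.closedBall (0 : A) 1)) (hb : b = x * u * y) :
    ContinuousOn Real.log (spectrum ℝ (star b * b)) ∧
    b * NormedSpace.exp (cfc (fun t ↦ -(Real.log t / 2)) (star b * b)) ∈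
      Set.extremePoints ℝ (Metric.closedBall (0 : A) 1) := by
  obtain ⟨x', hxx', hx'x⟩ := isUnit_iff_exists.1 hx
  obtain ⟨y', hyy', hy'y⟩ := isUnit_iff_exists.1 hy
  have huu := mul_star_mul_self_of_mem_extremePoints_closedBall hu
  have hreg : b * (y' * star u * x') * b = b := by
    calc b * (y' * star u * x') * b
        = x * (u * (y * y') * star u * (x' * x) * u) * y := by
          simp only [hb, mul_assoc]
      _ = b := by rw [hyy', hx'x, mul_one, mul_one, huu, hb]
  have hc := continuousOn_log_spectrum_star_mul_self hreg
  refine ⟨hc, ?_⟩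
  set s := star b * b with hs
  have hsa : IsSelfAdjoint s := IsSelfAdjoint.star_mul_self b
  have hs0 : 0 ≤ s := star_mul_self_nonneg b
  have hunit := isUnit_normedSpace_exp (cfc (fun t ↦ -(Real.log t / 2)) s)
  rw [exp_cfc_neg_half_log hsa hc] at hunit ⊢
  set f : ℝ → ℝ := fun t ↦ Real.exp (-(Real.log t / 2)) with hf
  have hfc : ContinuousOn f (spectrum ℝ s) := by fun_prop
  set k := cfc f s with hk
  have hkk : star k = k := cfc_predicate f s
  have hks : Commute k s := by
    have := cfc_commute_cfc f id s
    rwa [cfc_id ℝ s] at this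
  have hf2 : ∀ t ∈ spectrum ℝ s, t * (f t * t * f t) = t := by
    intro t ht
    by_cases ht0 : t = 0
    · simp [ht0]
    have hpos : 0 < t := lt_of_le_of_ne (spectrum_nonneg_of_nonneg hs0 ht) (Ne.symm ht0)
    have : f t * f t = t⁻¹ := by
      simp only [hf]
      rw [← Real.exp_add, ← neg_add, add_halves, Real.exp_neg, Real.exp_log hpos]
    calc t * (f t * t * f t) = t * t * (f t * f t) := by ring
      _ = t := by rw [this]; field_simp
  have hsks : s * (k * s * k) = s := by
    have h1 : cfc (fun t ↦ t * (f t * t * f t)) s = s * (k * s * k) := by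
      rw [cfc_mul _ _ s, cfc_mul _ _ s, cfc_mul _ _ s, cfc_id' ℝ s]
    rw [← h1, cfc_congr (g := id) hf2, cfc_id ℝ s]
  set v := b * k with hv
  have hvv : star v * v = k * s * k := by
    rw [hv, star_mul, hkk, hs]; simp only [mul_assoc]
  have hbp : b * (1 - star v * v) = 0 := by
    rw [← CStarRing.star_mul_self_eq_zero_iff, star_mul, mul_assoc, ← mul_assoc (star b), ← hs,
      hvv, mul_sub, mul_one, hsks, sub_self, mul_zero]
  have hkp : Commute k (1 - star v * v) := by
    rw [hvv]
    exact (Commute.one_right k).sub_right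
      (((Commute.refl k).mul_right hks).mul_right (Commute.refl k))
  have hvp : v * (1 - star v * v) = 0 := by
    rw [hv, mul_assoc, ← hv, hkp.eq, ← mul_assoc, hbp, zero_mul]
  have hpi : v * star v * v = v := by
    rw [mul_sub, mul_one, sub_eq_zero, ← mul_assoc] at hvp
    exact hvp.symm
  have hrb : (1 - v * star v) * b = 0 := by
    rw [← hunit.mul_left_eq_zero, mul_assoc, ← hv, sub_mul, one_mul, hpi, sub_self]
  have hrx : (1 - v * star v) * x = (1 - v * star v) * x * (1 - u * star u) := by
    have : (1 - v * star v) * x * u = 0 := by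
      rw [← hy.mul_left_eq_zero, mul_assoc, mul_assoc, ← mul_assoc x, ← hb, hrb]
    rw [mul_sub, mul_one, ← mul_assoc, this, zero_mul, sub_zero]
  have hyp : y * (1 - star v * v) = (1 - star u * u) * (y * (1 - star v * v)) := by
    have : u * (y * (1 - star v * v)) = 0 := by
      rw [← hx.mul_right_eq_zero, ← mul_assoc, ← mul_assoc, ← hb, hbp]
    rw [sub_mul, one_mul, mul_assoc, this, mul_zero, sub_zero]
  refine mem_extremePoints_closedBall_of_forall hpi fun a ↦ ?_
  calc (1 - v * star v) * a * (1 - star v * v)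
      = (1 - v * star v) * (x * x') * a * (y' * y) * (1 - star v * v) := by
        rw [hxx', hy'y, mul_one, mul_one]
    _ = ((1 - v * star v) * x) * (x' * a * y') * (y * (1 - star v * v)) := by
        simp only [mul_assoc]
    _ = (1 - v * star v) * x * ((1 - u * star u) * (x' * a * y') * (1 - star u * u)) *
          (y * (1 - star v * v)) := by
        conv_lhs => rw [hrx, hyp]
        simp only [mul_assoc]
    _ = 0 := by
        rw [defect_mul_defect_of_mem_extremePoints_closedBall hu, mul_zero, zero_mul]
end


/-- If `u` is extremal and `u + d` is close to `u`, then `u + d` is an invertible multiple of `u`. -/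
theorem add_eq_mul_mul_of_isUnit {A : Type*} [CStarAlgebra A] {u d : A}
    (hu : u ∈ Set.extremePoints ℝ (Metric.closedBall (0 : A) 1)) (hg : IsUnit (1 + star u * d)) :
    ∃ n : A, n * n = 0 ∧ u + d = (1 + n) * u * (1 + star u * d) := by
  obtain ⟨g', hgg', hg'g⟩ := isUnit_iff_exists.1 hg
  have huu := mul_star_mul_self_of_mem_extremePoints_closedBall hu
  have hur : star u * (1 - u * star u) = 0 := by
    have : star u * u * star u = star u := by simpa [mul_assoc] using congrArg star huu
    rw [mul_sub, mul_one, ← mul_assoc, this, sub_self]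
  refine ⟨(1 - u * star u) * (d * g') * star u, ?_, ?_⟩
  · calc (1 - u * star u) * (d * g') * star u * ((1 - u * star u) * (d * g') * star u)
        = (1 - u * star u) * (d * g') * (star u * (1 - u * star u)) * (d * g') * star u := by
          simp only [mul_assoc]
      _ = 0 := by simp only [hur, mul_zero, zero_mul]
  · have h := defect_mul_defect_of_mem_extremePoints_closedBall hu (d * g')
    rw [mul_sub, mul_one, sub_eq_zero] at h
    calc u + d = u * (1 + star u * d) + (1 - u * star u) * d := by noncomm_ring
      _ = u * (1 + star u * d) + (1 - u * star u) * (d * g') * (1 + star u * d) := by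
        rw [mul_assoc, mul_assoc d, hg'g, mul_one]
      _ = u * (1 + star u * d) +
          (1 - u * star u) * (d * g') * (star u * u) * (1 + star u * d) := by rw [← h]
      _ = _ := by simp only [add_mul, one_mul, mul_assoc]

theorem normedSpace_exp_of_mul_self_eq_zero {A : Type*} [CStarAlgebra A] {n : A}
    (h : n * n = 0) : NormedSpace.exp n = 1 + n := by
  have hz : ∀ k ∉ Finset.range 2, ((k.factorial : ℝ)⁻¹) • n ^ k = 0 := by
    intro k hk
    obtain ⟨j, rfl⟩ := Nat.exists_eq_add_of_le (not_lt.1 (Finset.mem_range.not.1 hk))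
    rw [pow_add, sq, h, zero_mul, smul_zero]
  rw [NormedSpace.exp_eq_tsum ℝ]
  simp only [tsum_eq_sum hz, Finset.sum_range_succ, Finset.sum_range_zero]
  simp

open scoped CStarAlgebra in
theorem StarAlgHom.map_normedSpace_exp {A B : Type*} [CStarAlgebra A] [CStarAlgebra B]
    (q : A →⋆ₐ[ℂ] B) (a : A) : q (NormedSpace.exp a) = NormedSpace.exp (q a) := by
  let _ : NormedAlgebra ℚ A := NormedAlgebra.restrictScalars ℚ ℝ A
  let _ : Algebra ℚ B := Algebra.compHom B (algebraMap ℚ ℝ)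
  exact NormedSpace.map_exp q (map_continuous q) a

open scoped CStarAlgebra in
theorem StarAlgHom.isOpenMap_of_surjective {A B : Type*} [CStarAlgebra A] [CStarAlgebra B]
    (q : A →⋆ₐ[ℂ] B) (hq : Function.Surjective q) : IsOpenMap q :=
  (⟨q.toAlgHom.toLinearMap, map_continuous q⟩ : A →L[ℂ] B).isOpenMap hq

open scoped CStarAlgebra in
/-- Extremal partial isometries lift from quotients of extremally rich C*-algebras. -/
theorem ExtremallyRich.exists_lift {A B : Type*} [CStarAlgebra A] [CStarAlgebra B]
    (hA : ExtremallyRich A) (q : A →⋆ₐ[ℂ] B) (hqsurj : Function.Surjective q) {u : B}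
    (hu : u ∈ Set.extremePoints ℝ (Metric.closedBall (0 : B) 1)) :
    ∃ v ∈ Set.extremePoints ℝ (Metric.closedBall (0 : A) 1), q v = u := by
  have hqc : Continuous q := map_continuous q
  have hqo := q.isOpenMap_of_surjective hqsurj
  -- elements of `A` close to a lift of `u` satisfy the hypothesis of the perturbation lemma
  have hopen : IsOpen {a : A | 1 + star u * (q a - u) ∈ q '' {z | IsUnit z}} :=
    (hqo _ Units.isOpen).preimage (by fun_prop)
  obtain ⟨a, ha⟩ := hqsurj u
  obtain ⟨c, hc, x, w, y, hx, hy, hw, rfl⟩ := hA.inter_open_nonempty _ hopen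
    ⟨a, by simpa [ha] using ⟨1, isUnit_one, map_one q⟩⟩
  obtain ⟨g, hg, hqg⟩ := hc
  obtain ⟨n, hn, hd⟩ := add_eq_mul_mul_of_isUnit (d := q (x * w * y) - u) hu
    (hqg ▸ (show IsUnit g from hg).map q)
  obtain ⟨m, rfl⟩ := hqsurj n
  rw [add_sub_cancel, ← hqg] at hd
  have hm : q (NormedSpace.exp m) = 1 + q m := by
    rw [q.map_normedSpace_exp, normedSpace_exp_of_mul_self_eq_zero hn]
  rw [← hm] at hd
  obtain ⟨e', hee', he'e⟩ := isUnit_iff_exists.1 (isUnit_normedSpace_exp m)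
  obtain ⟨g', hgg', hg'g⟩ := isUnit_iff_exists.1 (show IsUnit g from hg)
  have hqb : q (e' * x * w * (y * g')) = u := by
    calc q (e' * x * w * (y * g')) = q e' * q (x * w * y) * q g' := by
          simp only [map_mul, mul_assoc]
      _ = q (e' * NormedSpace.exp m) * u * q (g * g') := by
          rw [hd]; simp only [map_mul, mul_assoc]
      _ = u := by rw [he'e, hgg', map_one, one_mul, mul_one]
  have hex := (isUnit_iff_exists.2 ⟨_, he'e, hee'⟩).mul hx
  have hyg := hy.mul (isUnit_iff_exists.2 ⟨_, hg'g, hgg'⟩)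
  obtain ⟨hlog, hext⟩ := mul_exp_mem_extremePoints_closedBall hex hyg hw rfl
  refine ⟨_, hext, ?_⟩
  have huu : IsIdempotentElem (star u * u) := by
    rw [IsIdempotentElem, mul_assoc, ← mul_assoc u,
      mul_star_mul_self_of_mem_extremePoints_closedBall hu]
  rw [map_mul, q.map_normedSpace_exp, hqb, StarAlgHomClass.map_cfc (S := ℂ) q _ _
    (by fun_prop) hqc (IsSelfAdjoint.star_mul_self _) (by
      rw [map_mul, map_star, hqb]; exact IsSelfAdjoint.star_mul_self u),
    map_mul, map_star, hqb,
    cfc_congr (g := fun _ ↦ 0) (fun t ht ↦ by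
      rcases huu.spectrum_subset ℝ ht with rfl | rfl <;> simp),
    cfc_const_zero, NormedSpace.exp_zero, mul_one]

theorem isUnit_mul_mem_closure {A : Type*} [CStarAlgebra A] {h k c : A} (hh : IsUnit h)
    (hk : IsUnit k)
    (hc : c ∈ closure {a : A | ∃ x u y : A, IsUnit x ∧ IsUnit y ∧
      u ∈ Set.extremePoints ℝ (Metric.closedBall (0 : A) 1) ∧ a = x * u * y}) :
    h * c * k ∈ closure {a : A | ∃ x u y : A, IsUnit x ∧ IsUnit y ∧
      u ∈ Set.extremePoints ℝ (Metric.closedBall (0 : A) 1) ∧ a = x * u * y} := by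
  refine map_mem_closure (f := fun c ↦ h * c * k) (by fun_prop) hc ?_
  rintro _ ⟨x, u, y, hx, hy, hu, rfl⟩
  exact ⟨h * x, u, y * k, hh.mul hx, hy.mul hk, hu, by simp only [mul_assoc]⟩

open scoped CStarAlgebra in
theorem one_add_mem_closure_isUnit_of_dense {I A : Type*} [NonUnitalCStarAlgebra I]
    [CStarAlgebra A] (ι : I →⋆ₙₐ[ℂ] A) (hI : Dense {x : Unitization ℂ I | IsUnit x}) (j : I) :
    1 + ι j ∈ closure {a : A | IsUnit a} := by
  have h := map_mem_closure (map_continuous (Unitization.starLift ι)) (hI (1 + Unitization.inr j))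
    (t := {a : A | IsUnit a}) (fun x hx ↦ (show IsUnit x from hx).map _)
  have e : Unitization.starLift ι (1 + Unitization.inr j) = 1 + ι j := by
    rw [map_add, map_one]
    exact congrArg (1 + ·) (DFunLike.congr_fun (Unitization.starLift.symm_apply_apply ι) j)
  rwa [e] at h

/-- Let `I` be a closed two-sided ideal of a unital C*-algebra `A`
(realized by the isometric embedding `ι : I → A`), and let `q : A → B` realize the quotient
`B = A/I`.  If `I` has stable rank one and `B` is extremally rich, then `A` is extremally
rich if and only if every extremal partial isometry (extreme point of the closed unit ball)
in `A/I` lifts to an extremal partial isometry in `A`. -/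
theorem stmt3 {I A B : Type*} [NonUnitalCStarAlgebra I] [CStarAlgebra A] [CStarAlgebra B]
    (ι : I →⋆ₙₐ[ℂ] A) (hιisom : Isometry ι)
    (hideal : ∀ (a : A) (x : I), a * ι x ∈ Set.range ι ∧ ι x * a ∈ Set.range ι)
    (q : A →⋆ₐ[ℂ] B) (hqsurj : Function.Surjective q)
    (hker : ∀ a : A, q a = 0 ↔ a ∈ Set.range ι)
    (hI : Dense {x : Unitization ℂ I | IsUnit x})
    (hB : ExtremallyRich B) :
    ExtremallyRich A ↔
      ∀ u ∈ Set.extremePoints ℝ (Metric.closedBall (0 : B) 1),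
        ∃ v ∈ Set.extremePoints ℝ (Metric.closedBall (0 : A) 1), q v = u := by
  refine ⟨fun hA u hu ↦ hA.exists_lift q hqsurj hu, fun hlift a ↦ ?_⟩
  have hmem : a ∈ q ⁻¹' closure {b : B | ∃ x u y : B, IsUnit x ∧ IsUnit y ∧
      u ∈ Set.extremePoints ℝ (Metric.closedBall (0 : B) 1) ∧ b = x * u * y} := hB _
  have hcl := (q.isOpenMap_of_surjective hqsurj).preimage_closure_subset_closure_preimage hmem
  refine closure_minimal ?_ isClosed_closure hcl
  rintro c ⟨x, u, y, hx, hy, hu, hc⟩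
  -- reduce to an extremal partial isometry times an exponential, both of which lift
  obtain ⟨-, hext⟩ := mul_exp_mem_extremePoints_closedBall hx hy hu hc
  obtain ⟨v, hv, hqv⟩ := hlift _ hext
  obtain ⟨m, hm⟩ := hqsurj (cfc (fun t ↦ -(Real.log t / 2)) (star (q c) * q c))
  rw [← hm, ← q.map_normedSpace_exp] at hqv
  obtain ⟨e', hee', he'e⟩ := isUnit_iff_exists.1 (isUnit_normedSpace_exp m)
  obtain ⟨i, hi⟩ := (hker (c * NormedSpace.exp m - v)).1 (by
    rw [map_sub, map_mul, hqv, sub_self])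
  obtain ⟨j, hj⟩ := (hideal (star v) i).1
  have hce : c = 1 * (v + ι i) * e' := by
    rw [hi, add_sub_cancel, one_mul, mul_assoc, hee', mul_one]
  rw [hce]
  refine isUnit_mul_mem_closure isUnit_one (isUnit_iff_exists.2 ⟨_, he'e, hee'⟩) ?_
  -- replace `1 + star v * ι i` by a nearby invertible element `g`
  have hvi : v + ι i = v * (1 + ι j) + (1 - v * star v) * ι i := by
    rw [hj]; noncomm_ring
  rw [hvi]
  refine map_mem_closure (f := fun g ↦ v * g + (1 - v * star v) * ι i) (by fun_prop)
    (one_add_mem_closure_isUnit_of_dense ι hI j) fun g hg ↦ ?_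
  have hvv := mul_star_mul_self_of_mem_extremePoints_closedBall hv
  have hsv : star v * v * star v = star v := by simpa [mul_assoc] using congrArg star hvv
  obtain ⟨g', hgg', hg'g⟩ := isUnit_iff_exists.1 (show IsUnit g from hg)
  have hd : star v * ((1 - v * star v) * ι i * g') = 0 := by
    rw [← mul_assoc, ← mul_assoc, mul_sub, mul_one, ← mul_assoc, hsv, sub_self, zero_mul, zero_mul]
  obtain ⟨n, hn, hvd⟩ := add_eq_mul_mul_of_isUnit hv
    (show IsUnit (1 + star v * ((1 - v * star v) * ι i * g')) by
      rw [hd, add_zero]; exact isUnit_one)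
  rw [hd, add_zero, mul_one] at hvd
  refine ⟨1 + n, v, g, ?_, hg, hv, ?_⟩
  · rw [← normedSpace_exp_of_mul_self_eq_zero hn]
    exact isUnit_normedSpace_exp n
  · rw [← hvd, add_mul, mul_assoc _ g', hg'g, mul_one]
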